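/- arXiv:1306.3964 — 5 statements merged into one kernel-verified Lean document; each statement's English description precedes it below -/
import Mathlib

section
/- Let k be a field and A a unital associative k-algebra. If Δ₁ and Δ₂ are nearly Frobenius coproducts on A and α, β ∈ k, then the k-linear map α·Δ₁ + β·Δ₂ : A → A ⊗ A is again a nearly Frobenius coproduct on A. Consequently, the set of nearly Frobenius coproducts on A is a k-linear subspace of the space Hom_k(A, A ⊗ A) of k-linear maps from A to A ⊗ A. -/
open TensorProduct

/-- A nearly Frobenius coproduct on a unital associative `k`-algebra `A`:
a `k`-linear map `Δ : A → A ⊗[k] A` that is coassociative (up to the canonical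
associator) and a morphism of `A`-bimodules. -/
def IsNearlyFrobenius (k : Type*) [Field k] {A : Type*} [Ring A] [Algebra k A]
    (Δ : A →ₗ[k] A ⊗[k] A) : Prop :=
  (∀ a : A,
      TensorProduct.map Δ LinearMap.id (Δ a) =
        (TensorProduct.assoc k A A A).symm (TensorProduct.map LinearMap.id Δ (Δ a))) ∧
  (∀ a b : A, Δ (a * b) = (a ⊗ₜ[k] (1 : A)) * Δ b) ∧
  (∀ a b : A, Δ (a * b) = Δ a * ((1 : A) ⊗ₜ[k] b))

section

variable {k A : Type*} [Field k] [Ring A] [Algebra k A]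

theorem map_id_left_mul_eq (Δ : A →ₗ[k] A ⊗[k] A)
    (h : ∀ a b : A, Δ (a * b) = Δ a * ((1 : A) ⊗ₜ[k] b)) (a : A) (t : A ⊗[k] A) :
    TensorProduct.map Δ LinearMap.id ((a ⊗ₜ[k] (1 : A)) * t) =
      (Δ a ⊗ₜ[k] (1 : A)) * (TensorProduct.assoc k A A A).symm ((1 : A) ⊗ₜ[k] t) := by
  induction t with
  | zero => simp
  | tmul r s => simp [h]
  | add x y hx hy => simp only [mul_add, map_add, tmul_add, hx, hy]

theorem assoc_symm_tmul_mul (p q : A) (t : A ⊗[k] A) :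
    (TensorProduct.assoc k A A A).symm (p ⊗ₜ[k] ((q ⊗ₜ[k] (1 : A)) * t)) =
      ((p ⊗ₜ[k] q) ⊗ₜ[k] (1 : A)) *
        (TensorProduct.assoc k A A A).symm ((1 : A) ⊗ₜ[k] t) := by
  induction t with
  | zero => simp
  | tmul r s => simp
  | add x y hx hy => simp only [mul_add, map_add, tmul_add, hx, hy]

theorem assoc_symm_map_id_eq (Δ : A →ₗ[k] A ⊗[k] A)
    (h : ∀ a b : A, Δ (a * b) = (a ⊗ₜ[k] (1 : A)) * Δ b) (u : A ⊗[k] A) :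
    (TensorProduct.assoc k A A A).symm (TensorProduct.map LinearMap.id Δ u) =
      (u ⊗ₜ[k] (1 : A)) * (TensorProduct.assoc k A A A).symm ((1 : A) ⊗ₜ[k] Δ 1) := by
  induction u with
  | zero => simp
  | tmul p q =>
    rw [map_tmul, LinearMap.id_apply, ← assoc_symm_tmul_mul, ← h, mul_one]
  | add x y hx hy => simp only [add_mul, map_add, add_tmul, hx, hy]

/-- Coassociativity is automatic for a morphism of bimodules `A → A ⊗ A`. -/
theorem IsNearlyFrobenius.of_bimodule (Δ : A →ₗ[k] A ⊗[k] A)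
    (hl : ∀ a b : A, Δ (a * b) = (a ⊗ₜ[k] (1 : A)) * Δ b)
    (hr : ∀ a b : A, Δ (a * b) = Δ a * ((1 : A) ⊗ₜ[k] b)) : IsNearlyFrobenius k Δ := by
  refine ⟨fun a => ?_, hl, hr⟩
  rw [assoc_symm_map_id_eq Δ hl, ← map_id_left_mul_eq Δ hr, ← hl, mul_one]

variable (k A) in
/-- The subspace of nearly Frobenius coproducts on `A`. -/
def nearlyFrobeniusSubmodule : Submodule k (A →ₗ[k] A ⊗[k] A) where
  carrier := {Δ | IsNearlyFrobenius k Δ}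
  zero_mem' := .of_bimodule 0 (by simp) (by simp)
  add_mem' {Δ₁ Δ₂} h₁ h₂ := .of_bimodule (Δ₁ + Δ₂)
    (fun a b => by simp only [LinearMap.add_apply, mul_add, h₁.2.1 a b, h₂.2.1 a b])
    (fun a b => by simp only [LinearMap.add_apply, add_mul, h₁.2.2 a b, h₂.2.2 a b])
  smul_mem' c Δ h := .of_bimodule (c • Δ)
    (fun a b => by simp only [LinearMap.smul_apply, mul_smul_comm, h.2.1 a b])
    (fun a b => by simp only [LinearMap.smul_apply, smul_mul_assoc, h.2.2 a b])

end

/-- A `k`-linear combination of nearly Frobenius coproducts is a nearly Frobenius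
coproduct; consequently the nearly Frobenius coproducts on `A` form a `k`-linear
subspace of `Hom_k(A, A ⊗ A)`. -/
theorem nearlyFrobenius_linear_combination (k : Type*) [Field k] (A : Type*) [Ring A]
    [Algebra k A] (Δ₁ Δ₂ : A →ₗ[k] A ⊗[k] A)
    (h₁ : IsNearlyFrobenius k Δ₁) (h₂ : IsNearlyFrobenius k Δ₂) (α β : k) :
    IsNearlyFrobenius k (α • Δ₁ + β • Δ₂) ∧
    ∃ S : Submodule k (A →ₗ[k] A ⊗[k] A),
      (S : Set (A →ₗ[k] A ⊗[k] A)) = {Δ : A →ₗ[k] A ⊗[k] A | IsNearlyFrobenius k Δ} := by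
  exact ⟨(nearlyFrobeniusSubmodule k A).add_mem
    ((nearlyFrobeniusSubmodule k A).smul_mem α h₁)
    ((nearlyFrobeniusSubmodule k A).smul_mem β h₂), nearlyFrobeniusSubmodule k A, rfl⟩
end

section
/- Let k be a field, G a cyclic group of order n ≥ 2 with generator g, and A = kG its group algebra, with k-basis {g, g², …, gⁿ = 1}. For each m ∈ {2, …, n}, let Δ_m : A → A ⊗ A be the k-linear map determined by Δ_m(1) = Σ_{i=1}^{m-1} g^i ⊗ g^{m-i} + Σ_{i=m}^{n} g^i ⊗ g^{n+m-i} and Δ_m(a) = (a ⊗ 1) · Δ_m(1) for all a ∈ A. Then each Δ_m is a nearly Frobenius coproduct on kG and the family {Δ_m : 2 ≤ m ≤ n} is linearly independent over k; in particular the Frobenius dimension of kG is at least n − 1. -/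
open TensorProduct

/-- The generator `g` of the group algebra `k[ℤ/n]` of the cyclic group of order `n`. -/
noncomputable def cycGen (k : Type*) [Field k] (n : ℕ) :
    MonoidAlgebra k (Multiplicative (ZMod n)) :=
  MonoidAlgebra.of k (Multiplicative (ZMod n)) (Multiplicative.ofAdd (1 : ZMod n))

/-- The coproduct `Δ_m` on the group algebra `k[ℤ/n]` determined by
`Δ_m(1) = ∑_{i=1}^{m-1} gⁱ ⊗ g^{m-i} + ∑_{i=m}^{n} gⁱ ⊗ g^{n+m-i}` and
`Δ_m(a) = (a ⊗ 1) · Δ_m(1)`. -/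
noncomputable def cycDelta (k : Type*) [Field k] (n m : ℕ) :
    MonoidAlgebra k (Multiplicative (ZMod n)) →ₗ[k]
      MonoidAlgebra k (Multiplicative (ZMod n)) ⊗[k]
        MonoidAlgebra k (Multiplicative (ZMod n)) :=
  (LinearMap.mulRight k
      ((∑ i ∈ Finset.Ico 1 m, (cycGen k n ^ i) ⊗ₜ[k] (cycGen k n ^ (m - i))) +
        ∑ i ∈ Finset.Icc m n, (cycGen k n ^ i) ⊗ₜ[k] (cycGen k n ^ (n + m - i)))).comp
    (Algebra.TensorProduct.includeLeft
      (R := k) (A := MonoidAlgebra k (Multiplicative (ZMod n)))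
      (B := MonoidAlgebra k (Multiplicative (ZMod n)))).toLinearMap

/-- The element `g ^ x` of the group algebra `k[ℤ/n]`, for an exponent `x : ZMod n`. -/
noncomputable def cycPow (k : Type*) [Field k] (n : ℕ) (x : ZMod n) :
    MonoidAlgebra k (Multiplicative (ZMod n)) :=
  MonoidAlgebra.of k (Multiplicative (ZMod n)) (Multiplicative.ofAdd x)

lemma cycPow_mul (k : Type*) [Field k] (n : ℕ) (x y : ZMod n) :
    cycPow k n x * cycPow k n y = cycPow k n (x + y) := by
  simp only [cycPow, ofAdd_add, map_mul]

lemma cycPow_zero (k : Type*) [Field k] (n : ℕ) : cycPow k n 0 = 1 := by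
  simp only [cycPow, ofAdd_zero, map_one]

lemma cycGen_pow (k : Type*) [Field k] (n i : ℕ) : cycGen k n ^ i = cycPow k n (i : ZMod n) := by
  rw [cycGen, cycPow, ← map_pow, ← ofAdd_nsmul, nsmul_one]

/-- The powers of the generator form a basis of `k[ℤ/n]`. -/
noncomputable def cycBasis (k : Type*) [Field k] (n : ℕ) :
    Module.Basis (ZMod n) k (MonoidAlgebra k (Multiplicative (ZMod n))) :=
  (MonoidAlgebra.basis (Multiplicative (ZMod n)) k).reindex Multiplicative.toAdd

lemma cycBasis_apply (k : Type*) [Field k] (n : ℕ) (x : ZMod n) :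
    cycBasis k n x = cycPow k n x := by
  simp [cycBasis, cycPow]

lemma cycPow_induction (k : Type*) [Field k] (n : ℕ)
    {motive : MonoidAlgebra k (Multiplicative (ZMod n)) → Prop}
    (a : MonoidAlgebra k (Multiplicative (ZMod n))) (zero : motive 0)
    (add : ∀ a b, motive a → motive b → motive (a + b))
    (smul : ∀ (c : k) a, motive a → motive (c • a)) (pow : ∀ x, motive (cycPow k n x)) :
    motive a := by
  refine Submodule.span_induction (p := fun a _ => motive a) ?_ zero
    (fun a b _ _ => add a b) (fun c a _ => smul c a) ((cycBasis k n).mem_span a)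
  rintro _ ⟨x, rfl⟩
  rw [cycBasis_apply]
  exact pow x

/-- The element `∑ x, g ^ x ⊗ g ^ (s - x)` of `k[ℤ/n] ⊗ k[ℤ/n]`. -/
noncomputable def cycCasimir (k : Type*) [Field k] (n : ℕ) [NeZero n] (s : ZMod n) :
    MonoidAlgebra k (Multiplicative (ZMod n)) ⊗[k] MonoidAlgebra k (Multiplicative (ZMod n)) :=
  ∑ x : ZMod n, cycPow k n x ⊗ₜ[k] cycPow k n (s - x)

lemma cycPow_tmul_one_mul_cycCasimir (k : Type*) [Field k] (n : ℕ) [NeZero n] (y s : ZMod n) :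
    (cycPow k n y ⊗ₜ[k] 1) * cycCasimir k n s = cycCasimir k n (y + s) := by
  simp only [cycCasimir, Finset.mul_sum, Algebra.TensorProduct.tmul_mul_tmul, cycPow_mul, one_mul]
  refine Fintype.sum_equiv (Equiv.addLeft y) _ _ fun x => ?_
  simp only [Equiv.coe_addLeft, add_sub_add_left_eq_sub]

lemma cycCasimir_mul_one_tmul_cycPow (k : Type*) [Field k] (n : ℕ) [NeZero n] (y s : ZMod n) :
    cycCasimir k n s * (1 ⊗ₜ[k] cycPow k n y) = cycCasimir k n (y + s) := by
  simp only [cycCasimir, Finset.sum_mul, Algebra.TensorProduct.tmul_mul_tmul, cycPow_mul, mul_one]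
  refine Finset.sum_congr rfl fun x _ => ?_
  rw [show s - x + y = y + s - x by ring]

lemma tmul_one_mul_cycCasimir (k : Type*) [Field k] (n : ℕ) [NeZero n] (s : ZMod n)
    (a : MonoidAlgebra k (Multiplicative (ZMod n))) :
    (a ⊗ₜ[k] 1) * cycCasimir k n s = cycCasimir k n s * (1 ⊗ₜ[k] a) := by
  induction a using cycPow_induction with
  | zero => simp only [zero_tmul, tmul_zero, zero_mul, mul_zero]
  | add a b ha hb => rw [add_tmul, tmul_add, add_mul, mul_add, ha, hb]
  | smul c a ha => rw [← smul_tmul', tmul_smul, smul_mul_assoc, mul_smul_comm, ha]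
  | pow y =>
    rw [cycPow_tmul_one_mul_cycCasimir, cycCasimir_mul_one_tmul_cycPow]

lemma injOn_natCast_zmod (n : ℕ) :
    Set.InjOn (fun i : ℕ => (i : ZMod n)) (Finset.Icc 1 n) := by
  intro i hi j hj h
  simp only [Finset.coe_Icc, Set.mem_Icc] at hi hj
  have h_mod : i ≡ j [MOD n] := (ZMod.natCast_eq_natCast_iff i j n).1 h
  have h_pred : i - 1 ≡ j - 1 [MOD n] := by
    refine Nat.ModEq.add_right_cancel' 1 ?_
    rwa [Nat.sub_add_cancel hi.1, Nat.sub_add_cancel hj.1]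
  have := h_pred.eq_of_lt_of_lt (by lia) (by lia)
  lia

lemma sum_Icc_one_natCast_zmod {M : Type*} [AddCommMonoid M] (n : ℕ) [NeZero n] (f : ZMod n → M) :
    ∑ i ∈ Finset.Icc 1 n, f (i : ZMod n) = ∑ x, f x := by
  refine Finset.sum_nbij (fun i : ℕ => (i : ZMod n)) (fun _ _ => Finset.mem_univ _)
    (injOn_natCast_zmod n) ?_ fun _ _ => rfl
  intro x _
  refine ⟨(x - 1).val + 1, ?_, by simp⟩
  have := (x - 1).val_lt
  simp only [Finset.coe_Icc, Set.mem_Icc]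
  lia

lemma cycDelta_apply (k : Type*) [Field k] (n m : ℕ) [NeZero n] (hm : 2 ≤ m) (hmn : m ≤ n)
    (a : MonoidAlgebra k (Multiplicative (ZMod n))) :
    cycDelta k n m a = (a ⊗ₜ[k] 1) * cycCasimir k n (m : ZMod n) := by
  change (a ⊗ₜ[k] (1 : MonoidAlgebra k (Multiplicative (ZMod n)))) * _ = _
  congr 1
  rw [cycCasimir, ← sum_Icc_one_natCast_zmod n
    (fun x => cycPow k n x ⊗ₜ[k] cycPow k n ((m : ZMod n) - x)),
    ← Finset.Ico_add_one_right_eq_Icc 1 n,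
    ← Finset.sum_Ico_consecutive _ (by lia : 1 ≤ m) (by lia : m ≤ n + 1),
    ← Finset.Ico_add_one_right_eq_Icc m n]
  congr 1 <;> refine Finset.sum_congr rfl fun i hi => ?_ <;> rw [Finset.mem_Ico] at hi <;>
    rw [cycGen_pow, cycGen_pow, Nat.cast_sub (by lia)]
  simp

lemma cycDelta_cycPow (k : Type*) [Field k] (n m : ℕ) [NeZero n] (hm : 2 ≤ m) (hmn : m ≤ n)
    (y : ZMod n) : cycDelta k n m (cycPow k n y) = cycCasimir k n (y + m) := by
  rw [cycDelta_apply k n m hm hmn, cycPow_tmul_one_mul_cycCasimir]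

lemma cycDelta_coassoc (k : Type*) [Field k] (n m : ℕ) [NeZero n] (hm : 2 ≤ m) (hmn : m ≤ n)
    (a : MonoidAlgebra k (Multiplicative (ZMod n))) :
    TensorProduct.map (cycDelta k n m) LinearMap.id (cycDelta k n m a) =
      (TensorProduct.assoc k _ _ _).symm
        (TensorProduct.map LinearMap.id (cycDelta k n m) (cycDelta k n m a)) := by
  induction a using cycPow_induction with
  | zero => simp only [map_zero]
  | add a b ha hb => simp only [map_add, ha, hb]
  | smul c a ha => simp only [map_smul, ha]
  | pow y =>
    rw [cycDelta_cycPow k n m hm hmn, cycCasimir]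
    simp only [map_sum, TensorProduct.map_tmul, cycDelta_cycPow k n m hm hmn, LinearMap.id_apply,
      cycCasimir, sum_tmul, tmul_sum, TensorProduct.assoc_symm_tmul]
    rw [Finset.sum_comm]
    refine Finset.sum_congr rfl fun z _ => ?_
    refine Fintype.sum_equiv (Equiv.addRight ((m : ZMod n) - z)) _ _ fun x => ?_
    simp only [Equiv.coe_addRight, ← add_sub_assoc]
    rw [show y + (m : ZMod n) - z + m - (x + m - z) = y + m - x by ring]

lemma isNearlyFrobenius_cycDelta (k : Type*) [Field k] (n m : ℕ) (hm : 2 ≤ m) (hmn : m ≤ n) :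
    IsNearlyFrobenius k (cycDelta k n m) := by
  have : NeZero n := ⟨by lia⟩
  have h_left : ∀ a b, cycDelta k n m (a * b) = (a ⊗ₜ[k] 1) * cycDelta k n m b := fun a b => by
    rw [cycDelta_apply k n m hm hmn, cycDelta_apply k n m hm hmn, ← mul_assoc,
      Algebra.TensorProduct.tmul_mul_tmul, one_mul]
  refine ⟨cycDelta_coassoc k n m hm hmn, h_left, fun a b => ?_⟩
  rw [h_left, cycDelta_apply k n m hm hmn, cycDelta_apply k n m hm hmn, tmul_one_mul_cycCasimir,
    mul_assoc]

/-- The linear map `a ⊗ b ↦ a₀ • b`, where `a₀` is the coefficient of `1` in `a`. -/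
noncomputable def cycContract (k : Type*) [Field k] (n : ℕ) :
    MonoidAlgebra k (Multiplicative (ZMod n)) ⊗[k] MonoidAlgebra k (Multiplicative (ZMod n)) →ₗ[k]
      MonoidAlgebra k (Multiplicative (ZMod n)) :=
  TensorProduct.lift ((LinearMap.lsmul k _).comp ((cycBasis k n).coord 0))

lemma cycContract_cycCasimir (k : Type*) [Field k] (n : ℕ) [NeZero n] (s : ZMod n) :
    cycContract k n (cycCasimir k n s) = cycPow k n s := by
  simp only [cycContract, cycCasimir, map_sum, TensorProduct.lift.tmul, LinearMap.comp_apply,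
    LinearMap.lsmul_apply]
  rw [Finset.sum_eq_single 0]
  · simp [← cycBasis_apply]
  · intro x _ hx
    simp [← cycBasis_apply, hx]
  · simp

lemma linearIndependent_cycDelta (k : Type*) [Field k] (n : ℕ) (hn : 2 ≤ n) :
    LinearIndependent k
      (fun m : {m : ℕ // m ∈ Finset.Icc 2 n} => cycDelta k n (m : ℕ)) := by
  have : NeZero n := ⟨by lia⟩
  refine LinearIndependent.of_comp ((cycContract k n).comp (LinearMap.applyₗ 1)) ?_
  have h_inj : Function.Injective
      (fun m : {m : ℕ // m ∈ Finset.Icc 2 n} => ((m : ℕ) : ZMod n)) := by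
    refine fun i j h => Subtype.ext (injOn_natCast_zmod n ?_ ?_ h)
    · exact Finset.Icc_subset_Icc_left one_le_two i.2
    · exact Finset.Icc_subset_Icc_left one_le_two j.2
  convert (cycBasis k n).linearIndependent.comp _ h_inj using 1
  funext m
  obtain ⟨m, hm⟩ := m
  rw [Finset.mem_Icc] at hm
  simp only [Function.comp_apply, LinearMap.comp_apply, LinearMap.applyₗ_apply_apply]
  rw [← cycPow_zero, cycDelta_cycPow k n m hm.1 hm.2, cycContract_cycCasimir, zero_add,
    cycBasis_apply]

set_option maxSynthPendingDepth 5 in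
/-- Each `Δ_m` (for `2 ≤ m ≤ n`) is a nearly Frobenius coproduct on the group
algebra `k[ℤ/n]` of the cyclic group of order `n`, and the family
`{Δ_m : 2 ≤ m ≤ n}` is linearly independent; hence the Frobenius dimension of
`k[ℤ/n]` is at least `n - 1`. -/
theorem groupAlgebra_cyclic_nearlyFrobenius (k : Type*) [Field k] (n : ℕ) (hn : 2 ≤ n) :
    (∀ m : ℕ, 2 ≤ m → m ≤ n → IsNearlyFrobenius k (cycDelta k n m)) ∧
    LinearIndependent k
      (fun m : {m : ℕ // m ∈ Finset.Icc 2 n} => cycDelta k n (m : ℕ)) ∧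
    n - 1 ≤ Module.finrank k
      ↥(Submodule.span k
          {D : MonoidAlgebra k (Multiplicative (ZMod n)) →ₗ[k]
              MonoidAlgebra k (Multiplicative (ZMod n)) ⊗[k]
                MonoidAlgebra k (Multiplicative (ZMod n)) |
            IsNearlyFrobenius k D}) := by
  refine ⟨fun m => isNearlyFrobenius_cycDelta k n m, linearIndependent_cycDelta k n hn, ?_⟩
  have : NeZero n := ⟨by lia⟩
  have : Module.Finite k (MonoidAlgebra k (Multiplicative (ZMod n))) :=
    Module.Finite.of_basis (cycBasis k n)
  have h_card := finrank_span_eq_card (linearIndependent_cycDelta k n hn)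
  rw [Fintype.card_coe, Nat.card_Icc] at h_card
  rw [show n - 1 = n + 1 - 2 by lia, ← h_card]
  refine Submodule.finrank_mono (Submodule.span_mono ?_)
  rintro _ ⟨⟨m, hm⟩, rfl⟩
  rw [Finset.mem_Icc] at hm
  exact isNearlyFrobenius_cycDelta k n m hm.1 hm.2
end

section
/- Let k be a field, A and B unital associative k-algebras, and Δ_A, Δ_B nearly Frobenius coproducts on A and B respectively. Let ι_A : A → A × B, ι_A(a) = (a, 0), and ι_B : B → A × B, ι_B(b) = (0, b), be the canonical (non-unital) inclusions into the product algebra A × B (with componentwise operations). Then the k-linear map Δ : A × B → (A × B) ⊗ (A × B) defined by Δ(a, b) = (ι_A ⊗ ι_A)(Δ_A(a)) + (ι_B ⊗ ι_B)(Δ_B(b)) is a nearly Frobenius coproduct on A × B. In particular, a finite direct sum of nearly Frobenius algebras is a nearly Frobenius algebra. -/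
open TensorProduct

section

variable {k A C : Type*} [Field k] [Ring A] [Algebra k A] [Ring C] [Algebra k C]

theorem map_tmul_one_mul (f : A →ₗ[k] C) {a : A} {c : C} (h : ∀ x, f (a * x) = c * f x)
    (t : A ⊗[k] A) :
    TensorProduct.map f f ((a ⊗ₜ[k] (1 : A)) * t) =
      (c ⊗ₜ[k] (1 : C)) * TensorProduct.map f f t := by
  induction t with
  | zero => simp
  | tmul x y => simp [h]
  | add x y hx hy => simp only [mul_add, map_add, hx, hy]

theorem map_mul_one_tmul (f : A →ₗ[k] C) {a : A} {c : C} (h : ∀ x, f (x * a) = f x * c)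
    (t : A ⊗[k] A) :
    TensorProduct.map f f (t * ((1 : A) ⊗ₜ[k] a)) =
      TensorProduct.map f f t * ((1 : C) ⊗ₜ[k] c) := by
  induction t with
  | zero => simp
  | tmul x y => simp [h]
  | add x y hx hy => simp only [add_mul, map_add, hx, hy]

/-- A linear map that intertwines two coproducts carries coassociativity at a point
to coassociativity at its image. -/
theorem coassoc_apply_of_intertwines {ΔA : A →ₗ[k] A ⊗[k] A} {Δ : C →ₗ[k] C ⊗[k] C}
    (f : A →ₗ[k] C) (h : ∀ a, Δ (f a) = TensorProduct.map f f (ΔA a)) {a : A}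
    (ha : TensorProduct.map ΔA LinearMap.id (ΔA a) =
      (TensorProduct.assoc k A A A).symm (TensorProduct.map LinearMap.id ΔA (ΔA a))) :
    TensorProduct.map Δ LinearMap.id (Δ (f a)) =
      (TensorProduct.assoc k C C C).symm (TensorProduct.map LinearMap.id Δ (Δ (f a))) := by
  have hc : Δ ∘ₗ f = TensorProduct.map f f ∘ₗ ΔA := LinearMap.ext h
  have hl (t : A ⊗[k] A) : TensorProduct.map Δ LinearMap.id (TensorProduct.map f f t) =
      TensorProduct.map (TensorProduct.map f f) f (TensorProduct.map ΔA LinearMap.id t) := by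
    simp only [← LinearMap.comp_apply, ← TensorProduct.map_comp, hc, LinearMap.id_comp,
      LinearMap.comp_id]
  have hr (t : A ⊗[k] A) : TensorProduct.map LinearMap.id Δ (TensorProduct.map f f t) =
      TensorProduct.map f (TensorProduct.map f f) (TensorProduct.map LinearMap.id ΔA t) := by
    simp only [← LinearMap.comp_apply, ← TensorProduct.map_comp, hc, LinearMap.id_comp,
      LinearMap.comp_id]
  rw [h, hl, hr, ha, TensorProduct.map_map_assoc_symm]

end

/-- If `Δ_A` and `Δ_B` are nearly Frobenius coproducts on `A` and `B`, then
`(a, b) ↦ (ι_A ⊗ ι_A)(Δ_A a) + (ι_B ⊗ ι_B)(Δ_B b)` is a nearly Frobenius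
coproduct on the product algebra `A × B`; in particular a finite direct sum of
nearly Frobenius algebras is nearly Frobenius. -/
theorem prodAlgebra_nearlyFrobenius (k : Type*) [Field k] (A B : Type*)
    [Ring A] [Algebra k A] [Ring B] [Algebra k B]
    (ΔA : A →ₗ[k] A ⊗[k] A) (ΔB : B →ₗ[k] B ⊗[k] B)
    (hA : IsNearlyFrobenius k ΔA) (hB : IsNearlyFrobenius k ΔB) :
    IsNearlyFrobenius k
      ((TensorProduct.map (LinearMap.inl k A B) (LinearMap.inl k A B)).comp
          (ΔA.comp (LinearMap.fst k A B)) +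
        (TensorProduct.map (LinearMap.inr k A B) (LinearMap.inr k A B)).comp
          (ΔB.comp (LinearMap.snd k A B))) := by
  obtain ⟨cA, lA, rA⟩ := hA
  obtain ⟨cB, lB, rB⟩ := hB
  refine ⟨fun x => ?_, fun x y => ?_, fun x y => ?_⟩
  · have hx : x = LinearMap.inl k A B x.1 + LinearMap.inr k A B x.2 := by simp
    rw [hx]
    simp only [map_add _ (LinearMap.inl k A B x.1)]
    simp only [map_add]
    rw [coassoc_apply_of_intertwines (LinearMap.inl k A B) (fun a => by simp) (cA x.1),
      coassoc_apply_of_intertwines (LinearMap.inr k A B) (fun b => by simp) (cB x.2)]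
  · simp only [LinearMap.add_apply, LinearMap.comp_apply, LinearMap.fst_apply,
      LinearMap.snd_apply, Prod.fst_mul, Prod.snd_mul, lA, lB, mul_add]
    rw [map_tmul_one_mul (c := x) _ (fun a => by ext <;> simp),
      map_tmul_one_mul (c := x) _ (fun b => by ext <;> simp)]
  · simp only [LinearMap.add_apply, LinearMap.comp_apply, LinearMap.fst_apply,
      LinearMap.snd_apply, Prod.fst_mul, Prod.snd_mul, rA, rB, add_mul]
    rw [map_mul_one_tmul (c := y) _ (fun a => by ext <;> simp),
      map_mul_one_tmul (c := y) _ (fun b => by ext <;> simp)]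
end

section
/- Let k be a field, A and B unital associative k-algebras, and Δ_A, Δ_B nearly Frobenius coproducts on A and B respectively. Then the k-linear map Δ : A ⊗ B → (A ⊗ B) ⊗ (A ⊗ B) given by Δ = (id_A ⊗ τ ⊗ id_B) ∘ (Δ_A ⊗ Δ_B) (up to canonical associators), where τ : A ⊗ B → B ⊗ A is the flip, i.e. the map determined by Δ(a ⊗ b) = Σ (a₁ ⊗ b₁) ⊗ (a₂ ⊗ b₂) whenever Δ_A(a) = Σ a₁ ⊗ a₂ and Δ_B(b) = Σ b₁ ⊗ b₂, is a nearly Frobenius coproduct on the tensor product algebra A ⊗ B. -/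
open TensorProduct

namespace TensorProduct

variable {R A B : Type*} [CommSemiring R] [Semiring A] [Algebra R A] [Semiring B] [Algebra R B]

theorem tensorTensorTensorComm_mul_tmul (a a' : A ⊗[R] A) (b b' : B ⊗[R] B) :
    tensorTensorTensorComm R A A B B ((a * a') ⊗ₜ (b * b')) =
      tensorTensorTensorComm R A A B B (a ⊗ₜ b) * tensorTensorTensorComm R A A B B (a' ⊗ₜ b') := by
  rw [← Algebra.TensorProduct.tmul_mul_tmul]
  exact map_mul (Algebra.TensorProduct.tensorTensorTensorComm R R R R A A B B) (a ⊗ₜ b) (a' ⊗ₜ b')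

/-- The coproduct on `A ⊗ B` applied to the left factor of a shuffled tensor is the shuffle of the
coproducts applied to the left factors. -/
theorem map_comp_id_tensorTensorTensorComm (f : A →ₗ[R] A ⊗[R] A) (g : B →ₗ[R] B ⊗[R] B)
    (x : A ⊗[R] A) (y : B ⊗[R] B) :
    map ((tensorTensorTensorComm R A A B B).toLinearMap ∘ₗ map f g) LinearMap.id
        (tensorTensorTensorComm R A A B B (x ⊗ₜ y)) =
      map (tensorTensorTensorComm R A A B B).toLinearMap LinearMap.id
        (tensorTensorTensorComm R (A ⊗[R] A) A (B ⊗[R] B) B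
          (map f LinearMap.id x ⊗ₜ map g LinearMap.id y)) := by
  induction x with
  | zero => simp
  | add x₁ x₂ h₁ h₂ => simp only [add_tmul, map_add, h₁, h₂]
  | tmul a₁ a₂ =>
    induction y with
    | zero => simp
    | add y₁ y₂ h₁ h₂ => simp only [tmul_add, map_add, h₁, h₂]
    | tmul b₁ b₂ => simp

/-- The coproduct on `A ⊗ B` applied to the right factor of a shuffled tensor is the shuffle of the
coproducts applied to the right factors. -/
theorem map_id_comp_tensorTensorTensorComm (f : A →ₗ[R] A ⊗[R] A) (g : B →ₗ[R] B ⊗[R] B)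
    (x : A ⊗[R] A) (y : B ⊗[R] B) :
    map LinearMap.id ((tensorTensorTensorComm R A A B B).toLinearMap ∘ₗ map f g)
        (tensorTensorTensorComm R A A B B (x ⊗ₜ y)) =
      map LinearMap.id (tensorTensorTensorComm R A A B B).toLinearMap
        (tensorTensorTensorComm R A (A ⊗[R] A) B (B ⊗[R] B)
          (map LinearMap.id f x ⊗ₜ map LinearMap.id g y)) := by
  induction x with
  | zero => simp
  | add x₁ x₂ h₁ h₂ => simp only [add_tmul, map_add, h₁, h₂]
  | tmul a₁ a₂ =>
    induction y with
    | zero => simp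
    | add y₁ y₂ h₁ h₂ => simp only [tmul_add, map_add, h₁, h₂]
    | tmul b₁ b₂ => simp

theorem assoc_symm_map_id_tensorTensorTensorComm (u : A ⊗[R] (A ⊗[R] A)) (v : B ⊗[R] (B ⊗[R] B)) :
    (TensorProduct.assoc R (A ⊗[R] B) (A ⊗[R] B) (A ⊗[R] B)).symm
        (map LinearMap.id (tensorTensorTensorComm R A A B B).toLinearMap
          (tensorTensorTensorComm R A (A ⊗[R] A) B (B ⊗[R] B) (u ⊗ₜ v))) =
      map (tensorTensorTensorComm R A A B B).toLinearMap LinearMap.id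
        (tensorTensorTensorComm R (A ⊗[R] A) A (B ⊗[R] B) B
          ((TensorProduct.assoc R A A A).symm u ⊗ₜ (TensorProduct.assoc R B B B).symm v)) := by
  induction u with
  | zero => simp
  | add u₁ u₂ h₁ h₂ => simp only [add_tmul, map_add, h₁, h₂]
  | tmul a s =>
    induction s with
    | zero => simp
    | add s₁ s₂ h₁ h₂ => simp only [tmul_add, add_tmul, map_add, h₁, h₂]
    | tmul a₁ a₂ =>
      induction v with
      | zero => simp
      | add v₁ v₂ h₁ h₂ => simp only [tmul_add, map_add, h₁, h₂]
      | tmul b t =>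
        induction t with
        | zero => simp
        | add t₁ t₂ h₁ h₂ => simp only [tmul_add, map_add, h₁, h₂]
        | tmul b₁ b₂ => simp

end TensorProduct

/-- If `Δ_A` and `Δ_B` are nearly Frobenius coproducts on `A` and `B`, then
`(id ⊗ τ ⊗ id) ∘ (Δ_A ⊗ Δ_B)` is a nearly Frobenius coproduct on the tensor
product algebra `A ⊗[k] B`. -/
theorem tensorAlgebra_nearlyFrobenius (k : Type*) [Field k] (A B : Type*)
    [Ring A] [Algebra k A] [Ring B] [Algebra k B]
    (ΔA : A →ₗ[k] A ⊗[k] A) (ΔB : B →ₗ[k] B ⊗[k] B)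
    (hA : IsNearlyFrobenius k ΔA) (hB : IsNearlyFrobenius k ΔB) :
    IsNearlyFrobenius k
      ((TensorProduct.tensorTensorTensorComm k A A B B).toLinearMap.comp
        (TensorProduct.map ΔA ΔB)) := by
  obtain ⟨coassocA, leftA, rightA⟩ := hA
  obtain ⟨coassocB, leftB, rightB⟩ := hB
  refine ⟨fun z => ?_, fun x y => ?_, fun x y => ?_⟩
  · induction z with
    | zero => simp only [map_zero]
    | add z₁ z₂ h₁ h₂ => simp only [map_add, h₁, h₂]
    | tmul a b =>
      have h : ((TensorProduct.tensorTensorTensorComm k A A B B).toLinearMap.comp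
          (TensorProduct.map ΔA ΔB)) (a ⊗ₜ b) =
          TensorProduct.tensorTensorTensorComm k A A B B (ΔA a ⊗ₜ ΔB b) := rfl
      rw [h, TensorProduct.map_comp_id_tensorTensorTensorComm,
        TensorProduct.map_id_comp_tensorTensorTensorComm,
        TensorProduct.assoc_symm_map_id_tensorTensorTensorComm, coassocA, coassocB]
  · induction x with
    | zero => simp only [zero_mul, map_zero, TensorProduct.zero_tmul]
    | add x₁ x₂ h₁ h₂ => simp only [add_mul, map_add, TensorProduct.add_tmul, h₁, h₂]
    | tmul a b =>
      induction y with
      | zero => simp only [mul_zero, map_zero]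
      | add y₁ y₂ h₁ h₂ => simp only [mul_add, map_add, h₁, h₂]
      | tmul a' b' =>
        simp [leftA, leftB, TensorProduct.tensorTensorTensorComm_mul_tmul,
          Algebra.TensorProduct.one_def]
  · induction x with
    | zero => simp only [zero_mul, map_zero]
    | add x₁ x₂ h₁ h₂ => simp only [add_mul, map_add, h₁, h₂]
    | tmul a b =>
      induction y with
      | zero => simp only [mul_zero, map_zero, TensorProduct.tmul_zero]
      | add y₁ y₂ h₁ h₂ => simp only [mul_add, map_add, TensorProduct.tmul_add, h₁, h₂]
      | tmul a' b' =>
        simp [rightA, rightB, TensorProduct.tensorTensorTensorComm_mul_tmul,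
          Algebra.TensorProduct.one_def]
end

section
/- Let k be a field, A a unital associative k-algebra with a nearly Frobenius coproduct Δ, and J a nearly Frobenius ideal of (A, Δ). Let p : A → A/J be the quotient map. Then there exists a unique k-linear map Δ̄ : A/J → (A/J) ⊗ (A/J) such that Δ̄ ∘ p = (p ⊗ p) ∘ Δ, and this Δ̄ is a nearly Frobenius coproduct on the quotient algebra A/J (so that p is a morphism of nearly Frobenius algebras). -/
open TensorProduct

/-- A linear map vanishing on the kernel of a surjective linear map factors through it. -/
theorem LinearMap.exists_comp_eq_of_ker_le {k V W U : Type*} [Field k]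
    [AddCommGroup V] [Module k V] [AddCommGroup W] [Module k W] [AddCommGroup U] [Module k U]
    (p : V →ₗ[k] W) (hp : Function.Surjective p) (f : V →ₗ[k] U)
    (h : LinearMap.ker p ≤ LinearMap.ker f) : ∃ g : W →ₗ[k] U, g.comp p = f := by
  obtain ⟨s, hs⟩ := p.exists_rightInverse_of_surjective (LinearMap.range_eq_top.2 hp)
  refine ⟨f.comp s, LinearMap.ext fun a => ?_⟩
  have hmem : s (p a) - a ∈ LinearMap.ker p := by
    simpa [sub_eq_zero] using LinearMap.congr_fun hs (p a)
  simpa [sub_eq_zero] using h hmem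

/-- The square of a linear map `f` on tensors kills `J ⊗ A + A ⊗ J` when `f` kills `J`. -/
theorem TensorProduct.map_eq_zero_of_mem_sup_range {k V W : Type*} [Field k]
    [AddCommGroup V] [Module k V] [AddCommGroup W] [Module k W]
    (f : V →ₗ[k] W) (J : Submodule k V) (hJ : J ≤ LinearMap.ker f) {x : V ⊗[k] V}
    (hx : x ∈ LinearMap.range (TensorProduct.map J.subtype (LinearMap.id : V →ₗ[k] V)) ⊔
      LinearMap.range (TensorProduct.map (LinearMap.id : V →ₗ[k] V) J.subtype)) :
    TensorProduct.map f f x = 0 := by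
  have hf : f.comp J.subtype = 0 := LinearMap.ext fun j => hJ j.2
  refine (sup_le ?_ ?_ : _ ≤ LinearMap.ker (TensorProduct.map f f)) hx <;>
  · rintro _ ⟨y, rfl⟩
    rw [LinearMap.mem_ker, ← LinearMap.comp_apply, ← TensorProduct.map_comp, hf]
    simp

/-- A linear map compatible with a nearly Frobenius coproduct along a surjective algebra map is
itself a nearly Frobenius coproduct. -/
theorem IsNearlyFrobenius.of_surjective {k A B : Type*} [Field k]
    [Ring A] [Algebra k A] [Ring B] [Algebra k B]
    {Δ : A →ₗ[k] A ⊗[k] A} (hΔ : IsNearlyFrobenius k Δ)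
    (p : A →ₐ[k] B) (hp : Function.Surjective p) (δ : B →ₗ[k] B ⊗[k] B)
    (h : δ.comp p.toLinearMap = (TensorProduct.map p.toLinearMap p.toLinearMap).comp Δ) :
    IsNearlyFrobenius k δ := by
  obtain ⟨hcoassoc, hleft, hright⟩ := hΔ
  have hδ : ∀ a, δ (p a) = Algebra.TensorProduct.map p p (Δ a) := LinearMap.congr_fun h
  refine ⟨hp.forall.2 fun a => ?_, hp.forall.2 fun a => hp.forall.2 fun b => ?_,
    hp.forall.2 fun a => hp.forall.2 fun b => ?_⟩
  · have hl : TensorProduct.map δ LinearMap.id (δ (p a)) =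
        TensorProduct.map (TensorProduct.map p.toLinearMap p.toLinearMap) p.toLinearMap
          (TensorProduct.map Δ LinearMap.id (Δ a)) := by
      rw [show δ (p a) = TensorProduct.map p.toLinearMap p.toLinearMap (Δ a) from hδ a]
      simp only [TensorProduct.map_map, h, LinearMap.id_comp, LinearMap.comp_id]
    have hr : TensorProduct.map LinearMap.id δ (δ (p a)) =
        TensorProduct.map p.toLinearMap (TensorProduct.map p.toLinearMap p.toLinearMap)
          (TensorProduct.map LinearMap.id Δ (Δ a)) := by
      rw [show δ (p a) = TensorProduct.map p.toLinearMap p.toLinearMap (Δ a) from hδ a]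
      simp only [TensorProduct.map_map, h, LinearMap.id_comp, LinearMap.comp_id]
    rw [hl, hr, hcoassoc, TensorProduct.map_map_assoc_symm]
  · rw [← map_mul, hδ, hleft, map_mul, hδ]
    simp
  · rw [← map_mul, hδ, hright, map_mul, hδ]
    simp

/-- Quotient by a nearly Frobenius ideal: if `Δ` is a nearly Frobenius coproduct on
`A`, `p : A → B` is a surjective algebra map (presenting `B = A/J` with `J = ker p`),
and `Δ(J) ⊆ J ⊗ A + A ⊗ J`, then there is a unique linear map `Δ̄ : B → B ⊗ B`
with `Δ̄ ∘ p = (p ⊗ p) ∘ Δ`, and any such `Δ̄` is a nearly Frobenius coproduct on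
`B` (so that `p` is a morphism of nearly Frobenius algebras). -/
theorem quotient_nearlyFrobenius (k : Type*) [Field k] (A B : Type*)
    [Ring A] [Algebra k A] [Ring B] [Algebra k B]
    (Δ : A →ₗ[k] A ⊗[k] A) (hΔ : IsNearlyFrobenius k Δ)
    (p : A →ₐ[k] B) (hp : Function.Surjective p)
    (hJ : ∀ a : A, p a = 0 →
      Δ a ∈
        LinearMap.range (TensorProduct.map
            ((RingHom.ker p.toRingHom).restrictScalars k).subtype
            (LinearMap.id : A →ₗ[k] A)) ⊔
          LinearMap.range (TensorProduct.map (LinearMap.id : A →ₗ[k] A)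
            ((RingHom.ker p.toRingHom).restrictScalars k).subtype)) :
    (∃! Δbar : B →ₗ[k] B ⊗[k] B,
        Δbar.comp p.toLinearMap = (TensorProduct.map p.toLinearMap p.toLinearMap).comp Δ) ∧
    (∀ Δbar : B →ₗ[k] B ⊗[k] B,
      Δbar.comp p.toLinearMap = (TensorProduct.map p.toLinearMap p.toLinearMap).comp Δ →
      IsNearlyFrobenius k Δbar) := by
  refine ⟨?_, fun δ hδ => hΔ.of_surjective p hp δ hδ⟩
  obtain ⟨δ, hδ⟩ := LinearMap.exists_comp_eq_of_ker_le p.toLinearMap hp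
    ((TensorProduct.map p.toLinearMap p.toLinearMap).comp Δ) fun a ha =>
      TensorProduct.map_eq_zero_of_mem_sup_range p.toLinearMap _ (fun _ hj => hj) (hJ a ha)
  exact ⟨δ, hδ, fun δ' hδ' => (LinearMap.cancel_right hp).1 (hδ'.trans hδ.symm)⟩
end
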